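/- arXiv:2505.02960 — 3 statements merged into one kernel-verified Lean document; each statement's English description precedes it below -/
import Mathlib

section
/- Let u : Δ^{S_n}_{(1)} → U(n) be an admissible map. Then u extends to an admissible map on the 2-skeleton Δ^{S_n}_{(2)} if and only if for every 2-face g_0 < g_1 < g_2 of Δ^{S_n}, the loop γ^{g_0,g_1,g_2} := γ^{g_0,g_1} ∗ (U_{g_0⁻¹g_1}·γ^{g_1,g_2}) ∗ (γ^{g_0,g_2})⁻¹, based at the identity matrix, is null-homotopic within U(𝒫(Δ^{g_0,g_1,g_2})). -/
/-- The permutation matrix `U_g`, with `U_g e_i = e_{g i}`. -/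
def permMat {n : ℕ} (g : Equiv.Perm (Fin n)) : Matrix (Fin n) (Fin n) ℂ :=
  Matrix.of fun i j => if i = g j then 1 else 0

/-- `i` and `j` lie in the same orbit of the subgroup `G` of `S_n`. -/
def sameOrbit {n : ℕ} (G : Subgroup (Equiv.Perm (Fin n))) (i j : Fin n) : Prop :=
  ∃ p ∈ G, p i = j

/-- The subgroup of `S_n` generated by the differences `g⁻¹ * h` of elements of `S`;
for `S = {g₀, …, g_l}` it is the subgroup generated by `g₀⁻¹g₁, …, g₀⁻¹g_l`. -/
def groupOf {n : ℕ} (S : Finset (Equiv.Perm (Fin n))) : Subgroup (Equiv.Perm (Fin n)) :=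
  Subgroup.closure {q | ∃ g ∈ S, ∃ h ∈ S, q = g⁻¹ * h}

/-- The `k`-skeleton `Δ^{S_n}_{(k)}` of the simplex with vertices indexed by `S_n`:
points of the simplex with at most `k+1` nonzero coordinates. -/
def skel (n k : ℕ) : Set (Equiv.Perm (Fin n) → ℝ) :=
  {x | (∀ g, 0 ≤ x g) ∧ (∑ g, x g) = 1 ∧
    (Finset.univ.filter fun g => x g ≠ 0).card ≤ k + 1}

/-- The vertex of the simplex corresponding to `g ∈ S_n`. -/
def vertex {n : ℕ} (g : Equiv.Perm (Fin n)) : Equiv.Perm (Fin n) → ℝ :=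
  fun h => if h = g then 1 else 0

/-- A weakly admissible map on the `k`-skeleton: a continuous map `u` into `U(n)` such
that for every subsimplex `Δ^{g₀,…,g_l}` (support finset `S`, `l ≤ k`) and every point `x`
of it, `u x` lies in the coset `U_g · U(𝒫(Δ^{g₀,…,g_l}))` for `g ∈ S`; equivalently the
matrix `U_g⁻¹ · u x`, whose `(i,j)` entry is `u x (g i) j`, is block diagonal for the
orbit partition of the subgroup generated by the `g₀⁻¹gᵢ`. -/
def WeaklyAdmissible (n k : ℕ)
    (u : (Equiv.Perm (Fin n) → ℝ) → Matrix (Fin n) (Fin n) ℂ) : Prop :=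
  ContinuousOn u (skel n k) ∧
  (∀ x ∈ skel n k, u x ∈ Matrix.unitaryGroup (Fin n) ℂ) ∧
  ∀ S : Finset (Equiv.Perm (Fin n)), S.Nonempty → S.card ≤ k + 1 →
    ∀ x ∈ skel n k, (∀ g ∉ S, x g = 0) →
      ∀ g ∈ S, ∀ i j : Fin n, ¬ sameOrbit (groupOf S) i j → u x (g i) j = 0

/-- An admissible map on the `k`-skeleton: weakly admissible and sending every vertex `g`
to the permutation matrix `U_g`. -/
def Admissible (n k : ℕ)
    (u : (Equiv.Perm (Fin n) → ℝ) → Matrix (Fin n) (Fin n) ℂ) : Prop :=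
  WeaklyAdmissible n k u ∧ ∀ g : Equiv.Perm (Fin n), u (vertex g) = permMat g

/-- Determinant of the `B × B` submatrix of `M`. -/
noncomputable def blockDet {n : ℕ} (B : Finset (Fin n)) (M : Matrix (Fin n) (Fin n) ℂ) : ℂ :=
  (M.submatrix (fun i : {x // x ∈ B} => i.1) (fun j : {x // x ∈ B} => j.1)).det

/-- `B` is a block (equivalence class) of the relation `r`. -/
def IsBlock {n : ℕ} (r : Fin n → Fin n → Prop) (B : Finset (Fin n)) : Prop :=
  ∃ i, ∀ j, j ∈ B ↔ r i j

/-- `l` is a continuous lift of `f` on `[0,1]` through `x ↦ exp (2 π i x)`. -/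
def IsLiftOn (f : ℝ → ℂ) (l : ℝ → ℝ) : Prop :=
  ContinuousOn l (Set.Icc 0 1) ∧
    ∀ t ∈ Set.Icc (0 : ℝ) 1, f t = Complex.exp (2 * Real.pi * Complex.I * l t)

/-- The point `ε^{g₀,g₁}(t) = (1 - t)·g₀ + t·g₁` of the edge `Δ^{g₀,g₁}`. -/
def edgePt {n : ℕ} (g0 g1 : Equiv.Perm (Fin n)) (t : ℝ) : Equiv.Perm (Fin n) → ℝ :=
  fun h => (1 - t) * (if h = g0 then 1 else 0) + t * (if h = g1 then 1 else 0)

/-- The path `γ^{g₀,g₁} = U_{g₀}⁻¹ · (u ∘ ε^{g₀,g₁})`; the `(i,j)` entry of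
`U_{g₀}⁻¹ · M` is `M (g₀ i) j`. -/
def edgePath {n : ℕ} (u : (Equiv.Perm (Fin n) → ℝ) → Matrix (Fin n) (Fin n) ℂ)
    (g0 g1 : Equiv.Perm (Fin n)) (t : ℝ) : Matrix (Fin n) (Fin n) ℂ :=
  Matrix.of fun i j => u (edgePt g0 g1 t) (g0 i) j

/-- The set `U(𝒫)` of unitary matrices that are block diagonal for the relation `r`. -/
def blockUnitary {n : ℕ} (r : Fin n → Fin n → Prop) : Set (Matrix (Fin n) (Fin n) ℂ) :=
  {M | M ∈ Matrix.unitaryGroup (Fin n) ℂ ∧ ∀ i j, ¬ r i j → M i j = 0}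

/-- The boundary loop of the face `Δ^{g₀,g₁,g₂}`: the concatenation
`ε^{g₀,g₁} ∗ ε^{g₁,g₂} ∗ (ε^{g₀,g₂})⁻¹`. -/
noncomputable def triPt {n : ℕ} (g0 g1 g2 : Equiv.Perm (Fin n)) (t : ℝ) :
    Equiv.Perm (Fin n) → ℝ :=
  if t ≤ 1 / 3 then edgePt g0 g1 (3 * t)
  else if t ≤ 2 / 3 then edgePt g1 g2 (3 * t - 1)
  else edgePt g0 g2 (3 - 3 * t)

/-- The loop `γ^{g₀,g₁,g₂} = U_{g₀}⁻¹ · (u ∘ (ε^{g₀,g₁} ∗ ε^{g₁,g₂} ∗ (ε^{g₀,g₂})⁻¹))`,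
which is the concatenation `γ^{g₀,g₁} ∗ (U_{g₀⁻¹g₁}·γ^{g₁,g₂}) ∗ (γ^{g₀,g₂})⁻¹`, based at
the identity matrix. -/
noncomputable def triLoop {n : ℕ}
    (u : (Equiv.Perm (Fin n) → ℝ) → Matrix (Fin n) (Fin n) ℂ)
    (g0 g1 g2 : Equiv.Perm (Fin n)) (t : ℝ) : Matrix (Fin n) (Fin n) ℂ :=
  Matrix.of fun i j => u (triPt g0 g1 g2 t) (g0 i) j

/-- The loop `L`, based at the identity, is null-homotopic within `U(𝒫)`
(`𝒫` given by the relation `r`). -/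
def NullHomotopicIn {n : ℕ} (L : ℝ → Matrix (Fin n) (Fin n) ℂ)
    (r : Fin n → Fin n → Prop) : Prop :=
  ∃ H : ℝ → ℝ → Matrix (Fin n) (Fin n) ℂ,
    ContinuousOn (fun p : ℝ × ℝ => H p.1 p.2) (Set.Icc 0 1 ×ˢ Set.Icc 0 1) ∧
    (∀ s ∈ Set.Icc (0 : ℝ) 1, ∀ t ∈ Set.Icc (0 : ℝ) 1, H s t ∈ blockUnitary r) ∧
    (∀ t ∈ Set.Icc (0 : ℝ) 1, H 0 t = L t) ∧
    (∀ t ∈ Set.Icc (0 : ℝ) 1, H 1 t = 1) ∧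
    (∀ s ∈ Set.Icc (0 : ℝ) 1, H s 0 = 1 ∧ H s 1 = 1)

/-- The closed face of the simplex spanned by the vertices in `S`. -/
def closedFace {n : ℕ} (S : Finset (Equiv.Perm (Fin n))) : Set (Equiv.Perm (Fin n) → ℝ) :=
  {x | (∀ g, 0 ≤ x g) ∧ (∑ g, x g) = 1 ∧ ∀ g ∉ S, x g = 0}

/-- The cone coordinates `(s, t)` on a triangle: the point at parameter `s` of the segment
from the boundary point `triPt g0 g1 g2 t` to the apex `a`. -/
noncomputable def conePt {n : ℕ} (a : Equiv.Perm (Fin n) → ℝ) (g0 g1 g2 : Equiv.Perm (Fin n))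
    (p : ℝ × ℝ) : Equiv.Perm (Fin n) → ℝ :=
  fun h => (1 - p.1) * triPt g0 g1 g2 p.2 h + p.1 * a h

/-- The barycenter of the triangle with vertices `g0`, `g1`, `g2`. -/
noncomputable def triCenter {n : ℕ} (g0 g1 g2 : Equiv.Perm (Fin n)) :
    Equiv.Perm (Fin n) → ℝ :=
  fun h => if h = g0 ∨ h = g1 ∨ h = g2 then 1 / 3 else 0

theorem ContinuousOn.image_of_comp {A B X : Type*} [TopologicalSpace A] [TopologicalSpace B]
    [T2Space B] [TopologicalSpace X] {K : Set A} (hK : IsCompact K) {q : A → B}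
    (hq : ContinuousOn q K) {f : A → X} (hf : ContinuousOn f K) {F : B → X}
    (hF : ∀ a ∈ K, F (q a) = f a) : ContinuousOn F (q '' K) := by
  rw [continuousOn_iff_isClosed]
  intro C hC
  obtain ⟨D, hD, hDK⟩ := continuousOn_iff_isClosed.1 hf C hC
  refine ⟨q '' (D ∩ K), ?_, ?_⟩
  · exact ((hK.inter_left hD).image_of_continuousOn
      (hq.mono Set.inter_subset_right)).isClosed
  · rw [← hDK]
    ext x
    constructor
    · rintro ⟨hx, a, ha, rfl⟩
      refine ⟨⟨a, ⟨?_, ha⟩, rfl⟩, a, ha, rfl⟩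
      simpa [hF a ha] using hx
    · rintro ⟨⟨a, ⟨hx, ha⟩, rfl⟩, -⟩
      refine ⟨?_, a, ha, rfl⟩
      simpa [hF a ha] using hx

section Faces

variable {n : ℕ} {S : Finset (Equiv.Perm (Fin n))} {g0 g1 g2 : Equiv.Perm (Fin n)}
  {x y a : Equiv.Perm (Fin n) → ℝ} {k : ℕ}

theorem isClosed_closedFace (S : Finset (Equiv.Perm (Fin n))) : IsClosed (closedFace S) := by
  have h : closedFace S = (⋂ g, {x : Equiv.Perm (Fin n) → ℝ | 0 ≤ x g}) ∩
      ({x | (∑ g, x g) = 1} ∩ ⋂ g, ⋂ (_ : g ∉ S), {x | x g = 0}) := by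
    ext x; simp [closedFace]
  rw [h]
  refine (isClosed_iInter fun g => isClosed_le continuous_const (continuous_apply g)).inter
    ((isClosed_eq (by fun_prop) continuous_const).inter
      (isClosed_iInter fun g => isClosed_iInter fun _ =>
        isClosed_eq (continuous_apply g) continuous_const))

theorem closedFace_subset_skel (hS : S.card ≤ k + 1) : closedFace S ⊆ skel n k := by
  rintro x ⟨h0, h1, h2⟩
  refine ⟨h0, h1, (Finset.card_le_card ?_).trans hS⟩
  intro g hg
  by_contra h
  exact (Finset.mem_filter.1 hg).2 (h2 g h)

theorem mem_closedFace_support (hx : x ∈ skel n k) :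
    x ∈ closedFace (Finset.univ.filter fun g => x g ≠ 0) :=
  ⟨hx.1, hx.2.1, by simp⟩

theorem vertex_mem_closedFace {g : Equiv.Perm (Fin n)} (hg : g ∈ S) :
    vertex g ∈ closedFace S := by
  refine ⟨fun h => ?_, by simp [vertex], fun h hh => ?_⟩
  · unfold vertex; split_ifs <;> norm_num
  · unfold vertex
    rw [if_neg]
    rintro rfl
    exact hh hg

theorem combination_mem_closedFace (hx : x ∈ closedFace S) (hy : y ∈ closedFace S) {t : ℝ}
    (ht : t ∈ Set.Icc (0 : ℝ) 1) : (fun h => (1 - t) * x h + t * y h) ∈ closedFace S := by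
  refine ⟨fun g => ?_, ?_, fun g hg => ?_⟩
  · have := hx.1 g
    have := hy.1 g
    have := ht.1
    have : 0 ≤ 1 - t := by linarith [ht.2]
    positivity
  · rw [Finset.sum_add_distrib, ← Finset.mul_sum, ← Finset.mul_sum, hx.2.1, hy.2.1]
    ring
  · simp [hx.2.2 g hg, hy.2.2 g hg]

theorem edgePt_mem_closedFace (h0 : g0 ∈ S) (h1 : g1 ∈ S) {t : ℝ}
    (ht : t ∈ Set.Icc (0 : ℝ) 1) : edgePt g0 g1 t ∈ closedFace S :=
  combination_mem_closedFace (vertex_mem_closedFace h0) (vertex_mem_closedFace h1) ht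

theorem triPt_mem_closedFace (h0 : g0 ∈ S) (h1 : g1 ∈ S) (h2 : g2 ∈ S) {t : ℝ}
    (ht : t ∈ Set.Icc (0 : ℝ) 1) : triPt g0 g1 g2 t ∈ closedFace S := by
  obtain ⟨ht0, ht1⟩ := ht
  unfold triPt
  split_ifs with h h'
  · exact edgePt_mem_closedFace h0 h1 ⟨by linarith, by linarith⟩
  · exact edgePt_mem_closedFace h1 h2 ⟨by linarith, by linarith⟩
  · exact edgePt_mem_closedFace h0 h2 ⟨by linarith, by linarith⟩

theorem continuous_edgePt (g0 g1 : Equiv.Perm (Fin n)) : Continuous (edgePt g0 g1) := by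
  unfold edgePt
  fun_prop

theorem continuous_triPt (g0 g1 g2 : Equiv.Perm (Fin n)) : Continuous (triPt g0 g1 g2) := by
  unfold triPt
  refine Continuous.if_le ((continuous_edgePt g0 g1).comp (by fun_prop))
    (Continuous.if_le ((continuous_edgePt g1 g2).comp (by fun_prop))
      ((continuous_edgePt g0 g2).comp (by fun_prop)) continuous_id continuous_const ?_)
    continuous_id continuous_const ?_
  · rintro t rfl
    funext h
    norm_num [edgePt]
  · rintro t rfl
    rw [if_pos (by norm_num)]
    funext h
    norm_num [edgePt]

theorem continuous_conePt (a : Equiv.Perm (Fin n) → ℝ) (g0 g1 g2 : Equiv.Perm (Fin n)) :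
    Continuous (conePt a g0 g1 g2) := by
  have := continuous_triPt g0 g1 g2
  unfold conePt
  fun_prop

theorem conePt_mem_closedFace (h0 : g0 ∈ S) (h1 : g1 ∈ S) (h2 : g2 ∈ S)
    (ha : a ∈ closedFace S) {p : ℝ × ℝ} (hp : p ∈ Set.Icc (0 : ℝ) 1 ×ˢ Set.Icc (0 : ℝ) 1) :
    conePt a g0 g1 g2 p ∈ closedFace S :=
  combination_mem_closedFace (triPt_mem_closedFace h0 h1 h2 hp.2) ha hp.1

theorem triPt_zero (g0 g1 g2 : Equiv.Perm (Fin n)) : triPt g0 g1 g2 0 = vertex g0 := by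
  funext h
  simp [triPt, edgePt, vertex]

theorem triPt_one (g0 g1 g2 : Equiv.Perm (Fin n)) : triPt g0 g1 g2 1 = vertex g0 := by
  funext h
  norm_num [triPt, edgePt, vertex]

theorem sum_of_mem_closedFace (h01 : g0 ≠ g1) (h02 : g0 ≠ g2) (h12 : g1 ≠ g2)
    (hS : ∀ g, g ∈ S ↔ g = g0 ∨ g = g1 ∨ g = g2) (hx : x ∈ closedFace S) :
    x g0 + x g1 + x g2 = 1 := by
  have hS' : S = {g0, g1, g2} := by ext; simp [hS]
  rw [← hx.2.1, ← Finset.sum_subset (Finset.subset_univ S) (fun g _ hg => hx.2.2 g hg), hS',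
    Finset.sum_insert (by simp [h01, h02]), Finset.sum_pair h12, add_assoc]

theorem eq_of_mem_closedFace (hS : ∀ g, g ∈ S ↔ g = g0 ∨ g = g1 ∨ g = g2)
    (hx : x ∈ closedFace S) (hy : y ∈ closedFace S) (h0 : x g0 = y g0) (h1 : x g1 = y g1)
    (h2 : x g2 = y g2) : x = y := by
  funext g
  by_cases hg : g ∈ S
  · rcases (hS g).1 hg with rfl | rfl | rfl <;> assumption
  · rw [hx.2.2 g hg, hy.2.2 g hg]

theorem triCenter_mem_closedFace (h01 : g0 ≠ g1) (h02 : g0 ≠ g2) (h12 : g1 ≠ g2)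
    (hS : ∀ g, g ∈ S ↔ g = g0 ∨ g = g1 ∨ g = g2) : triCenter g0 g1 g2 ∈ closedFace S := by
  have hS' : S = {g0, g1, g2} := by ext; simp [hS]
  refine ⟨fun g => ?_, ?_, fun g hg => ?_⟩
  · unfold triCenter; split_ifs <;> norm_num
  · rw [← Finset.sum_subset (Finset.subset_univ S)
      (fun g _ hg => by simp [triCenter, ← hS, hg]), hS',
      Finset.sum_insert (by simp [h01, h02]), Finset.sum_pair h12]
    norm_num [triCenter]
  · simp [triCenter, ← hS, hg]

/-- Some barycentric coordinate of a boundary point vanishes. -/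
theorem exists_triPt_eq_zero (h01 : g0 ≠ g1) (h02 : g0 ≠ g2) (h12 : g1 ≠ g2) (t : ℝ) :
    triPt g0 g1 g2 t g0 = 0 ∨ triPt g0 g1 g2 t g1 = 0 ∨ triPt g0 g1 g2 t g2 = 0 := by
  unfold triPt
  split_ifs
  · right; right; simp [edgePt, h02.symm, h12.symm]
  · left; simp [edgePt, h01, h02]
  · right; left; simp [edgePt, h01.symm, h12]

theorem exists_eq_triPt (h01 : g0 ≠ g1) (h02 : g0 ≠ g2) (h12 : g1 ≠ g2)
    (hS : ∀ g, g ∈ S ↔ g = g0 ∨ g = g1 ∨ g = g2) (hx : x ∈ closedFace S)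
    (h : x g0 = 0 ∨ x g1 = 0 ∨ x g2 = 0) :
    ∃ t ∈ Set.Icc (0 : ℝ) 1, triPt g0 g1 g2 t = x := by
  have hsum := sum_of_mem_closedFace h01 h02 h12 hS hx
  have m0 : g0 ∈ S := by simp [hS]
  have m1 : g1 ∈ S := by simp [hS]
  have m2 : g2 ∈ S := by simp [hS]
  have p0 := hx.1 g0
  have p1 := hx.1 g1
  have p2 := hx.1 g2
  suffices H : ∃ t ∈ Set.Icc (0 : ℝ) 1, triPt g0 g1 g2 t g0 = x g0 ∧
      triPt g0 g1 g2 t g1 = x g1 ∧ triPt g0 g1 g2 t g2 = x g2 by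
    obtain ⟨t, ht, e0, e1, e2⟩ := H
    exact ⟨t, ht, eq_of_mem_closedFace hS (triPt_mem_closedFace m0 m1 m2 ht) hx e0 e1 e2⟩
  rcases h with h | h | h
  · by_cases hz : x g2 = 0
    · refine ⟨1 / 3, ⟨by norm_num, by norm_num⟩, ?_⟩
      norm_num [triPt, edgePt, h01, h02, h12, h01.symm, h02.symm, h12.symm]
      refine ⟨?_, ?_, ?_⟩ <;> linarith
    · have : 0 < x g2 := lt_of_le_of_ne p2 (Ne.symm hz)
      refine ⟨(1 + x g2) / 3, ⟨by linarith, by linarith⟩, ?_⟩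
      unfold triPt
      rw [if_neg (by linarith), if_pos (by linarith)]
      simp [edgePt, h01, h02, h12, h12.symm]
      refine ⟨?_, ?_, ?_⟩ <;> linarith
  · by_cases hz : x g2 = 1
    · refine ⟨2 / 3, ⟨by norm_num, by norm_num⟩, ?_⟩
      norm_num [triPt, edgePt, h01, h02, h12, h01.symm, h02.symm, h12.symm]
      refine ⟨?_, ?_, ?_⟩ <;> linarith
    · have : x g2 < 1 := lt_of_le_of_ne (by linarith) hz
      refine ⟨1 - x g2 / 3, ⟨by linarith, by linarith⟩, ?_⟩
      unfold triPt
      rw [if_neg (by linarith), if_neg (by linarith)]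
      simp [edgePt, h02, h12, h01.symm, h02.symm]
      refine ⟨?_, ?_, ?_⟩ <;> linarith
  · refine ⟨x g1 / 3, ⟨by linarith, by linarith⟩, ?_⟩
    unfold triPt
    rw [if_pos (by linarith)]
    simp [edgePt, h01, h01.symm, h02.symm, h12.symm]
    refine ⟨?_, ?_, ?_⟩ <;> linarith

theorem eq_or_endpoints_of_triPt_eq (h01 : g0 ≠ g1) (h02 : g0 ≠ g2) (h12 : g1 ≠ g2) {t t' : ℝ}
    (ht : t ∈ Set.Icc (0 : ℝ) 1) (ht' : t' ∈ Set.Icc (0 : ℝ) 1)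
    (h : triPt g0 g1 g2 t = triPt g0 g1 g2 t') :
    t = t' ∨ ((t = 0 ∨ t = 1) ∧ (t' = 0 ∨ t' = 1)) := by
  have e0 := congrFun h g0
  have e1 := congrFun h g1
  have e2 := congrFun h g2
  obtain ⟨l, r⟩ := ht
  obtain ⟨l', r'⟩ := ht'
  unfold triPt at e0 e1 e2
  split_ifs at e0 e1 e2 <;>
    simp [edgePt, h01, h02, h12, h01.symm, h02.symm, h12.symm] at e0 e1 e2 <;>
    first
    | (left; linarith)
    | (right; refine ⟨Or.inl ?_, Or.inr ?_⟩ <;> linarith)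
    | (right; refine ⟨Or.inr ?_, Or.inl ?_⟩ <;> linarith)

theorem exists_eq_conePt (h01 : g0 ≠ g1) (h02 : g0 ≠ g2) (h12 : g1 ≠ g2)
    (hS : ∀ g, g ∈ S ↔ g = g0 ∨ g = g1 ∨ g = g2) (hx : x ∈ closedFace S) :
    ∃ p ∈ Set.Icc (0 : ℝ) 1 ×ˢ Set.Icc (0 : ℝ) 1,
      conePt (triCenter g0 g1 g2) g0 g1 g2 p = x := by
  have hsum := sum_of_mem_closedFace h01 h02 h12 hS hx
  have m0 : g0 ∈ S := by simp [hS]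
  have m1 : g1 ∈ S := by simp [hS]
  have m2 : g2 ∈ S := by simp [hS]
  have hc := triCenter_mem_closedFace h01 h02 h12 hS
  obtain ⟨i, hi, hmin⟩ := S.exists_min_image x ⟨g0, m0⟩
  have l0 := hmin g0 m0
  have l1 := hmin g1 m1
  have l2 := hmin g2 m2
  have li := hx.1 i
  by_cases h1 : 3 * x i = 1
  · refine ⟨(1, 0), ⟨⟨by simp, by simp⟩, ⟨by simp, by simp⟩⟩, ?_⟩
    refine eq_of_mem_closedFace hS (conePt_mem_closedFace m0 m1 m2 hc
      ⟨⟨by simp, by simp⟩, ⟨by simp, by simp⟩⟩) hx ?_ ?_ ?_ <;>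
      simp [conePt, triCenter] <;> linarith
  · have hpos : 0 < 1 - 3 * x i := by
      have : 3 * x i ≤ 1 := by linarith
      have := lt_of_le_of_ne this h1
      linarith
    have hb : (fun g => (x g - 3 * x i * triCenter g0 g1 g2 g) / (1 - 3 * x i))
        ∈ closedFace S := by
      refine ⟨fun g => ?_, ?_, fun g hg => ?_⟩
      · refine div_nonneg ?_ hpos.le
        by_cases hg : g ∈ S
        · have := hmin g hg
          simp only [triCenter, if_pos ((hS g).1 hg)]
          linarith
        · rw [hx.2.2 g hg, hc.2.2 g hg]
          simp
      · rw [← Finset.sum_div, Finset.sum_sub_distrib, ← Finset.mul_sum, hx.2.1, hc.2.1, mul_one,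
          div_self hpos.ne']
      · simp [hx.2.2 g hg, hc.2.2 g hg]
    obtain ⟨t, ht, hbt⟩ := exists_eq_triPt h01 h02 h12 hS hb (by
      rcases (hS i).1 hi with rfl | rfl | rfl
      · left; simp [triCenter]; left; ring
      · right; left; simp [triCenter]; left; ring
      · right; right; simp [triCenter]; left; ring)
    refine ⟨(3 * x i, t), ⟨⟨by positivity, by linarith⟩, ht⟩, ?_⟩
    funext g
    simp only [conePt, hbt]
    field_simp
    ring

theorem image_conePt (h01 : g0 ≠ g1) (h02 : g0 ≠ g2) (h12 : g1 ≠ g2)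
    (hS : ∀ g, g ∈ S ↔ g = g0 ∨ g = g1 ∨ g = g2) :
    conePt (triCenter g0 g1 g2) g0 g1 g2 '' (Set.Icc (0 : ℝ) 1 ×ˢ Set.Icc (0 : ℝ) 1) =
      closedFace S := by
  ext x
  constructor
  · rintro ⟨p, hp, rfl⟩
    exact conePt_mem_closedFace (by simp [hS]) (by simp [hS]) (by simp [hS])
      (triCenter_mem_closedFace h01 h02 h12 hS) hp
  · exact exists_eq_conePt h01 h02 h12 hS

theorem conePt_fst_eq (h01 : g0 ≠ g1) (h02 : g0 ≠ g2) (h12 : g1 ≠ g2) {p p' : ℝ × ℝ}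
    (hp : p ∈ Set.Icc (0 : ℝ) 1 ×ˢ Set.Icc (0 : ℝ) 1)
    (h : conePt (triCenter g0 g1 g2) g0 g1 g2 p = conePt (triCenter g0 g1 g2) g0 g1 g2 p') :
    p.1 ≤ p'.1 := by
  have key : ∀ g, g = g0 ∨ g = g1 ∨ g = g2 → triPt g0 g1 g2 p'.2 g = 0 → p.1 ≤ p'.1 := by
    intro g hg hz
    have hg' := congrFun h g
    simp only [conePt, triCenter, if_pos hg, hz] at hg'
    have h0 : 0 ≤ triPt g0 g1 g2 p.2 g :=
      (triPt_mem_closedFace (S := Finset.univ) (by simp) (by simp) (by simp) hp.2).1 g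
    have : 0 ≤ (1 - p.1) * triPt g0 g1 g2 p.2 g := mul_nonneg (by linarith [hp.1.2]) h0
    linarith
  rcases exists_triPt_eq_zero h01 h02 h12 p'.2 with hz | hz | hz
  · exact key g0 (by simp) hz
  · exact key g1 (by simp) hz
  · exact key g2 (by simp) hz

/-- A map on the square that is constant on three of its sides descends along the cone
coordinates to a continuous map on the triangle. -/
theorem exists_continuousOn_closedFace {X : Type*} [TopologicalSpace X] (h01 : g0 ≠ g1)
    (h02 : g0 ≠ g2) (h12 : g1 ≠ g2) (hS : ∀ g, g ∈ S ↔ g = g0 ∨ g = g1 ∨ g = g2)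
    {H : ℝ → ℝ → X} {c : X}
    (hH : ContinuousOn (fun p : ℝ × ℝ => H p.1 p.2) (Set.Icc 0 1 ×ˢ Set.Icc 0 1))
    (h1 : ∀ t ∈ Set.Icc (0 : ℝ) 1, H 1 t = c)
    (he : ∀ s ∈ Set.Icc (0 : ℝ) 1, H s 0 = c ∧ H s 1 = c) :
    ∃ F : (Equiv.Perm (Fin n) → ℝ) → X, ContinuousOn F (closedFace S) ∧
      ∀ p ∈ Set.Icc (0 : ℝ) 1 ×ˢ Set.Icc (0 : ℝ) 1,
        F (conePt (triCenter g0 g1 g2) g0 g1 g2 p) = H p.1 p.2 := by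
  set K := Set.Icc (0 : ℝ) 1 ×ˢ Set.Icc (0 : ℝ) 1
  set q := conePt (triCenter g0 g1 g2) g0 g1 g2 with hq
  have wd : ∀ p ∈ K, ∀ p' ∈ K, q p = q p' → H p.1 p.2 = H p'.1 p'.2 := by
    rintro ⟨s, t⟩ hp ⟨s', t'⟩ hp' h
    have hs : s = s' := le_antisymm (conePt_fst_eq h01 h02 h12 hp h)
      (conePt_fst_eq h01 h02 h12 hp' h.symm)
    subst hs
    by_cases hs1 : s = 1
    · subst hs1
      simp only [h1 t hp.2, h1 t' hp'.2]
    · have htri : triPt g0 g1 g2 t = triPt g0 g1 g2 t' := by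
        funext g
        have := congrFun h g
        simp only [hq, conePt, add_left_inj] at this
        exact mul_left_cancel₀ (sub_ne_zero.2 (Ne.symm hs1)) this
      have e := he s hp.1
      rcases eq_or_endpoints_of_triPt_eq h01 h02 h12 hp.2 hp'.2 htri with
        rfl | ⟨rfl | rfl, rfl | rfl⟩ <;> simp [e.1, e.2]
  have hF : ∀ p ∈ K, (fun x => H (Function.invFunOn q K x).1 (Function.invFunOn q K x).2) (q p)
      = H p.1 p.2 := fun p hp =>
    wd _ (Function.invFunOn_mem ⟨p, hp, rfl⟩) _ hp (Function.invFunOn_eq ⟨p, hp, rfl⟩)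
  refine ⟨fun x => H (Function.invFunOn q K x).1 (Function.invFunOn q K x).2, ?_, hF⟩
  rw [← image_conePt h01 h02 h12 hS]
  exact ContinuousOn.image_of_comp (isCompact_Icc.prod isCompact_Icc)
    (continuous_conePt _ _ _ _).continuousOn hH hF

end Faces

section Orbits

variable {n : ℕ} {S T : Finset (Equiv.Perm (Fin n))}

theorem groupOf_mono (h : S ⊆ T) : groupOf S ≤ groupOf T :=
  Subgroup.closure_mono fun _ ⟨g, hg, k, hk, e⟩ => ⟨g, h hg, k, h hk, e⟩

theorem inv_mul_mem_groupOf {g h : Equiv.Perm (Fin n)} (hg : g ∈ S) (hh : h ∈ S) :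
    g⁻¹ * h ∈ groupOf S :=
  Subgroup.subset_closure ⟨g, hg, h, hh, rfl⟩

/-- The coset `U_g · U(𝒫)` does not depend on the vertex `g` of the subsimplex. -/
theorem block_condition_change_vertex {M : Matrix (Fin n) (Fin n) ℂ} {g h : Equiv.Perm (Fin n)}
    (hg : g ∈ S) (hh : h ∈ S)
    (hM : ∀ i j, ¬ sameOrbit (groupOf S) i j → M (g i) j = 0) (i j : Fin n)
    (hij : ¬ sameOrbit (groupOf S) i j) : M (h i) j = 0 := by
  have := hM ((g⁻¹ * h) i) j (by
    rintro ⟨p, hp, e⟩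
    exact hij ⟨p * (g⁻¹ * h), mul_mem hp (inv_mul_mem_groupOf hg hh), by simpa using e⟩)
  simpa using this

theorem submatrix_mem_unitaryGroup {M : Matrix (Fin n) (Fin n) ℂ}
    (hM : M ∈ Matrix.unitaryGroup (Fin n) ℂ) (g : Equiv.Perm (Fin n)) :
    M.submatrix g id ∈ Matrix.unitaryGroup (Fin n) ℂ := by
  rw [Matrix.mem_unitaryGroup_iff] at hM ⊢
  rw [Matrix.star_eq_conjTranspose] at hM ⊢
  rw [Matrix.conjTranspose_submatrix, ← Equiv.coe_refl, Matrix.submatrix_mul_equiv, hM,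
    Matrix.submatrix_one_equiv]

theorem permMat_submatrix (g : Equiv.Perm (Fin n)) : (permMat g).submatrix g id = 1 := by
  ext i j
  simp [permMat, Matrix.one_apply]

end Orbits

/-- A null-homotopy of the boundary loop of a triangle gives an extension over the triangle. -/
theorem NullHomotopicIn.exists_extension {n : ℕ}
    {u : (Equiv.Perm (Fin n) → ℝ) → Matrix (Fin n) (Fin n) ℂ}
    {S : Finset (Equiv.Perm (Fin n))} {g0 g1 g2 : Equiv.Perm (Fin n)} (h01 : g0 ≠ g1)
    (h02 : g0 ≠ g2) (h12 : g1 ≠ g2) (hS : ∀ g, g ∈ S ↔ g = g0 ∨ g = g1 ∨ g = g2)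
    (h : NullHomotopicIn (triLoop u g0 g1 g2) (sameOrbit (groupOf S))) :
    ∃ F : (Equiv.Perm (Fin n) → ℝ) → Matrix (Fin n) (Fin n) ℂ,
      ContinuousOn F (closedFace S) ∧
      (∀ x ∈ closedFace S, F x ∈ Matrix.unitaryGroup (Fin n) ℂ) ∧
      (∀ x ∈ closedFace S, ∀ g ∈ S, ∀ i j, ¬ sameOrbit (groupOf S) i j → F x (g i) j = 0) ∧
      ∀ x ∈ closedFace S, x ∈ skel n 1 → F x = u x := by
  obtain ⟨H, hH, hU, h0, h1, he⟩ := h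
  obtain ⟨F, hF, hFH⟩ := exists_continuousOn_closedFace h01 h02 h12 hS hH h1 he
  have m0 : g0 ∈ S := by simp [hS]
  refine ⟨fun x => (F x).submatrix g0.symm id, ?_, ?_, ?_, ?_⟩
  · exact (continuous_id.matrix_submatrix _ _).comp_continuousOn hF
  · intro x hx
    obtain ⟨p, hp, rfl⟩ := exists_eq_conePt h01 h02 h12 hS hx
    simp only [hFH p hp]
    exact submatrix_mem_unitaryGroup (hU _ hp.1 _ hp.2).1 _
  · intro x hx g hg
    obtain ⟨p, hp, rfl⟩ := exists_eq_conePt h01 h02 h12 hS hx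
    refine block_condition_change_vertex m0 hg fun i j hij => ?_
    simpa [hFH p hp] using (hU _ hp.1 _ hp.2).2 i j hij
  · intro x hx hx1
    have hz : x g0 = 0 ∨ x g1 = 0 ∨ x g2 = 0 := by
      by_contra! hne
      have hsub : ({g0, g1, g2} : Finset _) ⊆ Finset.univ.filter fun g => x g ≠ 0 := by
        intro g hg
        simp only [Finset.mem_insert, Finset.mem_singleton] at hg
        rcases hg with rfl | rfl | rfl <;> simp [hne]
      have := Finset.card_le_card hsub
      rw [Finset.card_eq_three.2 ⟨g0, g1, g2, h01, h02, h12, rfl⟩] at this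
      have := hx1.2.2
      omega
    obtain ⟨t, ht, rfl⟩ := exists_eq_triPt h01 h02 h12 hS hx hz
    have hq := hFH (0, t) ⟨⟨le_rfl, zero_le_one⟩, ht⟩
    have hc : conePt (triCenter g0 g1 g2) g0 g1 g2 (0, t) = triPt g0 g1 g2 t := by
      funext g
      simp [conePt]
    rw [hc] at hq
    simp only [hq, h0 t ht]
    ext i j
    simp [triLoop]

/-- Extensions over the triangles assemble to an extension over the 2-skeleton. -/
theorem Admissible.exists_extension {n : ℕ}
    {u : (Equiv.Perm (Fin n) → ℝ) → Matrix (Fin n) (Fin n) ℂ} (hu : Admissible n 1 u)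
    (h : ∀ S : Finset (Equiv.Perm (Fin n)), S.card = 3 →
      ∃ F : (Equiv.Perm (Fin n) → ℝ) → Matrix (Fin n) (Fin n) ℂ,
        ContinuousOn F (closedFace S) ∧
        (∀ x ∈ closedFace S, F x ∈ Matrix.unitaryGroup (Fin n) ℂ) ∧
        (∀ x ∈ closedFace S, ∀ g ∈ S, ∀ i j, ¬ sameOrbit (groupOf S) i j → F x (g i) j = 0) ∧
        ∀ x ∈ closedFace S, x ∈ skel n 1 → F x = u x) :
    ∃ u', Admissible n 2 u' ∧ ∀ x ∈ skel n 1, u' x = u x := by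
  classical
  obtain ⟨⟨huc, huU, hub⟩, huv⟩ := hu
  choose! F hFc hFU hFb hFu using h
  let supp : (Equiv.Perm (Fin n) → ℝ) → Finset (Equiv.Perm (Fin n)) := fun x =>
    Finset.univ.filter fun g => x g ≠ 0
  let u' : (Equiv.Perm (Fin n) → ℝ) → Matrix (Fin n) (Fin n) ℂ := fun x =>
    if x ∈ skel n 1 then u x else F (supp x) x
  have hu1 : ∀ x ∈ skel n 1, u' x = u x := fun x hx => if_pos hx
  have hu2 : ∀ x ∉ skel n 1, u' x = F (supp x) x := fun x hx => if_neg hx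
  have hcard : ∀ x ∈ skel n 2, x ∉ skel n 1 → (supp x).card = 3 := by
    intro x hx hx1
    have h2 : (supp x).card ≤ 2 + 1 := hx.2.2
    have h1 : ¬ (supp x).card ≤ 1 + 1 := fun h => hx1 ⟨hx.1, hx.2.1, h⟩
    omega
  have hsupp : ∀ T, ∀ x ∈ closedFace T, supp x ⊆ T := by
    intro T x hx g hg
    by_contra hgT
    exact (Finset.mem_filter.1 hg).2 (hx.2.2 g hgT)
  refine ⟨u', ⟨⟨?_, ?_, ?_⟩, fun g => ?_⟩, hu1⟩
  · have hcover : skel n 2 ⊆ ⋃ S : {S : Finset (Equiv.Perm (Fin n)) // S.card ≤ 2 + 1},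
        closedFace S.1 := fun x hx =>
      Set.mem_iUnion.2 ⟨⟨supp x, hx.2.2⟩, mem_closedFace_support hx⟩
    refine ContinuousOn.mono ?_ hcover
    refine (locallyFinite_of_finite _).continuousOn_iUnion
      (fun S => isClosed_closedFace S.1) ?_
    rintro ⟨S, hS⟩
    rcases Nat.lt_or_ge S.card 3 with hlt | hge
    · have hsub : closedFace S ⊆ skel n 1 := closedFace_subset_skel (by omega)
      exact (huc.mono hsub).congr fun x hx => hu1 x (hsub hx)
    · have h3 : S.card = 3 := by omega
      refine (hFc S h3).congr fun x hx => ?_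
      by_cases hx1 : x ∈ skel n 1
      · rw [hu1 x hx1, hFu S h3 x hx hx1]
      · have hs : supp x = S := Finset.eq_of_subset_of_card_le (hsupp S x hx)
          (by rw [hcard x (closedFace_subset_skel hS hx) hx1, h3])
        rw [hu2 x hx1, hs]
  · intro x hx
    by_cases hx1 : x ∈ skel n 1
    · rw [hu1 x hx1]
      exact huU x hx1
    · rw [hu2 x hx1]
      exact hFU _ (hcard x hx hx1) x (mem_closedFace_support hx)
  · intro T _ _ x hx hxT g hg
    have hsT : supp x ⊆ T := hsupp T x ⟨hx.1, hx.2.1, hxT⟩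
    have hne : (supp x).Nonempty := by
      by_contra hemp
      have hzero : ∀ g, x g = 0 := fun g => by
        by_contra hg0
        exact hemp ⟨g, by simp [supp, hg0]⟩
      have := hx.2.1
      simp [hzero] at this
    obtain ⟨k, hk⟩ := hne
    refine block_condition_change_vertex (hsT hk) hg fun i j hij => ?_
    have hij' : ¬ sameOrbit (groupOf (supp x)) i j := fun ⟨p, hp, e⟩ =>
      hij ⟨p, groupOf_mono hsT hp, e⟩
    by_cases hx1 : x ∈ skel n 1
    · rw [hu1 x hx1]
      exact hub (supp x) ⟨k, hk⟩ hx1.2.2 x hx1 (mem_closedFace_support hx).2.2 k hk i j hij'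
    · rw [hu2 x hx1]
      exact hFb _ (hcard x hx hx1) x (mem_closedFace_support hx) k hk i j hij'
  · have hv : vertex g ∈ closedFace {g} := vertex_mem_closedFace (Finset.mem_singleton_self g)
    rw [hu1 _ (closedFace_subset_skel (by simp) hv), huv]

/-- An admissible extension over a triangle contracts its boundary loop. -/
theorem Admissible.nullHomotopicIn {n : ℕ}
    {u u' : (Equiv.Perm (Fin n) → ℝ) → Matrix (Fin n) (Fin n) ℂ} (hu' : Admissible n 2 u')
    (h : ∀ x ∈ skel n 1, u' x = u x) {S : Finset (Equiv.Perm (Fin n))} (hS3 : S.card ≤ 3)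
    {g0 g1 g2 : Equiv.Perm (Fin n)} (m0 : g0 ∈ S) (m1 : g1 ∈ S) (m2 : g2 ∈ S) :
    NullHomotopicIn (triLoop u g0 g1 g2) (sameOrbit (groupOf S)) := by
  obtain ⟨⟨huc, huU, hub⟩, huv⟩ := hu'
  have hmem : ∀ p ∈ Set.Icc (0 : ℝ) 1 ×ˢ Set.Icc (0 : ℝ) 1,
      conePt (vertex g0) g0 g1 g2 p ∈ closedFace S := fun p hp =>
    conePt_mem_closedFace m0 m1 m2 (vertex_mem_closedFace m0) hp
  have hskel : closedFace S ⊆ skel n 2 := closedFace_subset_skel hS3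
  have hbase : ∀ p : ℝ × ℝ, conePt (vertex g0) g0 g1 g2 p = vertex g0 →
      (u' (conePt (vertex g0) g0 g1 g2 p)).submatrix g0 id = 1 := by
    intro p hp
    rw [hp, huv, permMat_submatrix]
  refine ⟨fun s t => (u' (conePt (vertex g0) g0 g1 g2 (s, t))).submatrix g0 id,
    ?_, ?_, ?_, ?_, ?_⟩
  · refine (continuous_id.matrix_submatrix _ _).comp_continuousOn
      (huc.comp (continuous_conePt _ _ _ _).continuousOn fun p hp => hskel (hmem p hp))
  · intro s hs t ht
    have hx := hmem (s, t) ⟨hs, ht⟩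
    exact ⟨submatrix_mem_unitaryGroup (huU _ (hskel hx)) g0,
      hub S ⟨g0, m0⟩ hS3 _ (hskel hx) hx.2.2 g0 m0⟩
  · intro t ht
    have hc : conePt (vertex g0) g0 g1 g2 (0, t) = triPt g0 g1 g2 t := by
      funext g
      simp [conePt]
    have h1 : triPt g0 g1 g2 t ∈ skel n 1 := by
      obtain ⟨ht0, ht1⟩ := ht
      have hedge : ∀ a b : Equiv.Perm (Fin n), ∀ r ∈ Set.Icc (0 : ℝ) 1,
          edgePt a b r ∈ skel n 1 := fun a b r hr =>
        closedFace_subset_skel (S := {a, b}) Finset.card_le_two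
          (edgePt_mem_closedFace (by simp) (by simp) hr)
      unfold triPt
      split_ifs
      · exact hedge _ _ _ ⟨by linarith, by linarith⟩
      · exact hedge _ _ _ ⟨by linarith, by linarith⟩
      · exact hedge _ _ _ ⟨by linarith, by linarith⟩
    simp only [hc, h _ h1]
    rfl
  · intro t _
    refine hbase _ ?_
    funext g
    simp [conePt]
  · intro s _
    refine ⟨hbase _ ?_, hbase _ ?_⟩
    · funext g
      simp only [conePt, triPt_zero]
      ring
    · funext g
      simp only [conePt, triPt_one]
      ring

theorem Finset.exists_lt_lt_of_card_eq_three {α : Type*} [LinearOrder α] {S : Finset α}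
    (hS : S.card = 3) : ∃ a b c, a < b ∧ b < c ∧ ∀ g, g ∈ S ↔ g = a ∨ g = b ∨ g = c := by
  have e := S.range_orderEmbOfFin hS
  refine ⟨S.orderEmbOfFin hS 0, S.orderEmbOfFin hS 1, S.orderEmbOfFin hS 2, by simp, by simp,
    fun g => ?_⟩
  rw [← Finset.mem_coe, ← e, Set.mem_range, Fin.exists_fin_succ, Fin.exists_fin_two]
  simp [eq_comm]

/-- an admissible map on the 1-skeleton of `Δ^{S_n}` extends to an
admissible map on the 2-skeleton iff for every 2-face `g₀ < g₁ < g₂` the loop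
`γ^{g₀,g₁,g₂}` is null-homotopic within `U(𝒫(Δ^{g₀,g₁,g₂}))`. -/
theorem admissible_extends_iff_loops_nullhomotopic {n : ℕ}
    [LinearOrder (Equiv.Perm (Fin n))]
    (u : (Equiv.Perm (Fin n) → ℝ) → Matrix (Fin n) (Fin n) ℂ)
    (hu : Admissible n 1 u) :
    (∃ u', Admissible n 2 u' ∧ ∀ x ∈ skel n 1, u' x = u x) ↔
    ∀ g0 g1 g2 : Equiv.Perm (Fin n), g0 < g1 → g1 < g2 →
      NullHomotopicIn (triLoop u g0 g1 g2) (sameOrbit (groupOf {g0, g1, g2})) := by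
  constructor
  · rintro ⟨u', hu', h⟩ g0 g1 g2 _ _
    exact hu'.nullHomotopicIn h Finset.card_le_three (by simp) (by simp) (by simp)
  · intro h
    refine hu.exists_extension fun S hS3 => ?_
    obtain ⟨g0, g1, g2, h01, h12, hS⟩ := Finset.exists_lt_lt_of_card_eq_three hS3
    have hS' : S = {g0, g1, g2} := by ext; simp [hS]
    refine NullHomotopicIn.exists_extension h01.ne (h01.trans h12).ne h12.ne hS ?_
    rw [hS']
    exact h g0 g1 g2 h01 h12
end

section
/- If there exists a unitary equivalence u : X → U(n) between n-variable dynamical systems (X, σ) and (X, τ), then (X, σ) and (X, τ) are piecewise equivalent: there exists an open cover {W_g}_{g ∈ S_n} of X such that τ_i(x) = σ_{g⁻¹(i)}(x) for all x ∈ W_g and all i ∈ {1, …, n}. -/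
/-- A square matrix with nonzero determinant has a transversal of nonzero entries. -/
theorem Matrix.exists_perm_forall_apply_ne_zero {ι R : Type*} [Fintype ι] [DecidableEq ι]
    [CommRing R] {M : Matrix ι ι R} (hM : M.det ≠ 0) :
    ∃ g : Equiv.Perm ι, ∀ i, M (g i) i ≠ 0 := by
  contrapose! hM
  rw [Matrix.det_apply]
  refine Finset.sum_eq_zero fun g _ => ?_
  obtain ⟨i, hi⟩ := hM g
  have hprod : ∏ j, M (g j) j = 0 := Finset.prod_eq_zero (Finset.mem_univ i) hi
  rw [hprod, smul_zero]

/-- if there exists a unitary equivalence `u : X → U(n)` between the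
`n`-variable dynamical systems `(X, σ)` and `(X, τ)`, then the systems are piecewise
equivalent: there is an open cover `{W_g}_{g ∈ S_n}` of `X` with `τ_i = σ_{g⁻¹(i)}`
on `W_g` for all `i`. -/
theorem unitary_equivalence_implies_piecewise_equivalent {n : ℕ} {X : Type*}
    [TopologicalSpace X] [CompactSpace X] [T2Space X]
    (σ τ : Fin n → X → X) (hσ : ∀ i, Continuous (σ i)) (hτ : ∀ i, Continuous (τ i))
    (h : ∃ u : X → Matrix (Fin n) (Fin n) ℂ, Continuous u ∧
      (∀ x, u x ∈ Matrix.unitaryGroup (Fin n) ℂ) ∧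
      ∀ x, ∀ i j : Fin n, u x i j ≠ 0 → τ i x = σ j x) :
    ∃ W : Equiv.Perm (Fin n) → Set X,
      (∀ g, IsOpen (W g)) ∧ (⋃ g, W g) = Set.univ ∧
      ∀ g, ∀ x ∈ W g, ∀ i : Fin n, τ i x = σ (g⁻¹ i) x := by
  obtain ⟨u, hu, hunit, heq⟩ := h
  refine ⟨fun g => {x | ∀ i, u x i (g⁻¹ i) ≠ 0}, fun g => ?_, ?_, fun g x hx i => heq x i _ (hx i)⟩
  · simp only [Set.ofPred_forall]
    exact isOpen_iInter_of_finite fun i => isOpen_ne_fun (hu.matrix_elem i (g⁻¹ i)) continuous_const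
  · refine Set.eq_univ_of_forall fun x => ?_
    have hdet : (u x).det ≠ 0 :=
      right_ne_zero_of_mul_eq_one (Matrix.det_of_mem_unitary (hunit x)).1
    obtain ⟨g, hg⟩ := Matrix.exists_perm_forall_apply_ne_zero hdet
    refine Set.mem_iUnion.2 ⟨g, fun i => ?_⟩
    simpa using hg (g⁻¹ i)
end

section
/- Let u : X → U(n) be a unitary equivalence between n-variable dynamical systems (X, σ) and (X, τ). Then for every x ∈ X, the set {y ∈ X : y is an isolated point of X and σ_i(y) = x for some i ∈ {1, …, n}} equals the set {y ∈ X : y is an isolated point of X and τ_i(y) = x for some i ∈ {1, …, n}}; in particular the counting functions I_σ and I_τ coincide. -/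
theorem Matrix.exists_row_ne_zero_of_mul_eq_one {ι R : Type*} [Fintype ι] [DecidableEq ι]
    [Semiring R] [Nontrivial R] {A B : Matrix ι ι R} (h : A * B = 1) (i : ι) :
    ∃ j, A i j ≠ 0 := by
  by_contra! hA
  simpa [Matrix.mul_apply, hA] using congr_fun (congr_fun h i) i

theorem Matrix.exists_col_ne_zero_of_mul_eq_one {ι R : Type*} [Fintype ι] [DecidableEq ι]
    [Semiring R] [Nontrivial R] {A B : Matrix ι ι R} (h : B * A = 1) (j : ι) :
    ∃ i, A i j ≠ 0 := by
  by_contra! hA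
  simpa [Matrix.mul_apply, hA] using congr_fun (congr_fun h j) j

/-- if `u` is a unitary equivalence between the `n`-variable dynamical
systems `(X, σ)` and `(X, τ)`, then for every `x ∈ X` the set of isolated points of `X`
mapped to `x` by some `σ_i` equals the set of isolated points mapped to `x` by some
`τ_i`; in particular the counting functions `I_σ` and `I_τ` coincide. -/
theorem isolated_preimages_eq {n : ℕ} {X : Type*} [TopologicalSpace X]
    [CompactSpace X] [T2Space X]
    (σ τ : Fin n → X → X) (hσ : ∀ i, Continuous (σ i)) (hτ : ∀ i, Continuous (τ i))
    (u : X → Matrix (Fin n) (Fin n) ℂ) (huc : Continuous u)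
    (huni : ∀ x, u x ∈ Matrix.unitaryGroup (Fin n) ℂ)
    (hue : ∀ x, ∀ i j : Fin n, u x i j ≠ 0 → τ i x = σ j x) (x : X) :
    {y : X | IsOpen ({y} : Set X) ∧ ∃ i : Fin n, σ i y = x} =
      {y : X | IsOpen ({y} : Set X) ∧ ∃ i : Fin n, τ i y = x} ∧
    Set.ncard {y : X | IsOpen ({y} : Set X) ∧ ∃ i : Fin n, σ i y = x} =
      Set.ncard {y : X | IsOpen ({y} : Set X) ∧ ∃ i : Fin n, τ i y = x} := by
  have range_eq (y : X) : (∃ i, σ i y = x) ↔ ∃ i, τ i y = x := by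
    constructor
    · rintro ⟨j, rfl⟩
      obtain ⟨i, hi⟩ := Matrix.exists_col_ne_zero_of_mul_eq_one
        (Matrix.mem_unitaryGroup_iff'.1 (huni y)) j
      exact ⟨i, hue y i j hi⟩
    · rintro ⟨i, rfl⟩
      obtain ⟨j, hj⟩ := Matrix.exists_row_ne_zero_of_mul_eq_one
        (Matrix.mem_unitaryGroup_iff.1 (huni y)) i
      exact ⟨j, (hue y i j hj).symm⟩
  simp only [range_eq, and_self]
end
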